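/- Dyadic pigeonhole selection: let (X, μ) be a measure space, γ ∈ [1,∞), and g : X → [0,∞] measurable with ∫_X g^γ dμ ≤ K < ∞. Then for every j ∈ ℕ there exists λ ∈ [2^(2^j), 2^(2^(j+1))) (which can be taken of the form λ = 2^(2^j + k) for some k ∈ {0,…,2^j − 1}) such that λ^γ · μ({x ∈ X : g(x) > 2λ}) ≤ 2^{−j} K. -/

import Mathlib

open MeasureTheory Filter
open scoped ENNReal

/-- A geometric sum of ratio at least two is dominated by the next term. -/
theorem ENNReal.sum_range_pow_add_le {a : ℝ≥0∞} (ha : 2 ≤ a) (N n : ℕ) :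
    ∑ k ∈ Finset.range n, a ^ (N + k) ≤ a ^ (N + n) := by
  induction n with
  | zero => simp
  | succ n ih =>
    calc ∑ k ∈ Finset.range (n + 1), a ^ (N + k)
        ≤ a ^ (N + n) + a ^ (N + n) := by
          rw [Finset.sum_range_succ]
          gcongr
      _ = 2 * a ^ (N + n) := (two_mul _).symm
      _ ≤ a * a ^ (N + n) := by gcongr
      _ = a ^ (N + (n + 1)) := by rw [← add_assoc, pow_succ']

/-- The dyadic levels lying below `t / 2` have `γ`-th powers summing to at most `t ^ γ`. -/
theorem ENNReal.sum_dyadic_levels_le_rpow {γ : ℝ} (hγ : 1 ≤ γ) (t : ℝ≥0∞) (N n : ℕ) :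
    ∑ k ∈ Finset.range n, (if 2 ^ (N + k + 1) < t then ((2 : ℝ≥0∞) ^ γ) ^ (N + k) else 0)
      ≤ t ^ γ := by
  have ha : (2 : ℝ≥0∞) ≤ 2 ^ γ := by
    simpa using ENNReal.rpow_le_rpow_of_exponent_le (x := 2) (by norm_num) hγ
  induction n with
  | zero => simp
  | succ n ih =>
    by_cases h : 2 ^ (N + n + 1) < t
    · calc _ ≤ ∑ k ∈ Finset.range (n + 1), ((2 : ℝ≥0∞) ^ γ) ^ (N + k) :=
            Finset.sum_le_sum fun k _ => by split_ifs <;> simp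
        _ ≤ ((2 : ℝ≥0∞) ^ γ) ^ (N + (n + 1)) := sum_range_pow_add_le ha N (n + 1)
        _ = ((2 : ℝ≥0∞) ^ (N + n + 1)) ^ γ := by
            rw [← ENNReal.rpow_natCast, ← ENNReal.rpow_natCast, ← ENNReal.rpow_mul,
              ← ENNReal.rpow_mul, mul_comm γ, ← add_assoc]
        _ ≤ t ^ γ := ENNReal.rpow_le_rpow h.le (by linarith)
    · rw [Finset.sum_range_succ, if_neg h, add_zero]
      exact ih

/-- The weighted measures of the dyadic super-level sets sum to at most `∫ g ^ γ`. -/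
theorem sum_dyadic_levels_mul_measure_le_lintegral {X : Type*} [MeasurableSpace X]
    (μ : Measure X) {γ : ℝ} (hγ : 1 ≤ γ) {g : X → ℝ≥0∞} (hg : Measurable g) (N n : ℕ) :
    ∑ k ∈ Finset.range n, ((2 : ℝ≥0∞) ^ γ) ^ (N + k) * μ {x | 2 ^ (N + k + 1) < g x}
      ≤ ∫⁻ x, g x ^ γ ∂μ := by
  have hs (k : ℕ) : MeasurableSet {x | 2 ^ (N + k + 1) < g x} :=
    measurableSet_lt measurable_const hg
  calc _ = ∑ k ∈ Finset.range n, ∫⁻ x,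
          {x | 2 ^ (N + k + 1) < g x}.indicator (fun _ => ((2 : ℝ≥0∞) ^ γ) ^ (N + k)) x ∂μ :=
        Finset.sum_congr rfl fun k _ => (lintegral_indicator_const (hs k) _).symm
    _ = ∫⁻ x, ∑ k ∈ Finset.range n,
          {x | 2 ^ (N + k + 1) < g x}.indicator (fun _ => ((2 : ℝ≥0∞) ^ γ) ^ (N + k)) x ∂μ :=
        (lintegral_finsetSum _ fun k _ => measurable_const.indicator (hs k)).symm
    _ ≤ ∫⁻ x, g x ^ γ ∂μ := lintegral_mono fun x => by
        simpa [Set.indicator_apply] using ENNReal.sum_dyadic_levels_le_rpow hγ (g x) N n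

/-- Dyadic pigeonhole selection: if `∫ g^γ dμ ≤ K < ∞` and `γ ≥ 1`, then for every `j` there
is a level `λ = 2^(2^j + k)` with `k ∈ {0,…,2^j−1}` (so `λ ∈ [2^(2^j), 2^(2^(j+1)))`) such
that `λ^γ μ({g > 2λ}) ≤ 2^{-j} K`. -/
theorem dyadic_pigeonhole_level_selection
    {X : Type*} [MeasurableSpace X] (μ : Measure X)
    (γ : ℝ) (hγ : 1 ≤ γ)
    (g : X → ℝ≥0∞) (hg : Measurable g)
    (K : ℝ≥0∞) (hK : K < ⊤)
    (hint : ∫⁻ x, g x ^ γ ∂μ ≤ K) (j : ℕ) :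
    ∃ lam : ℝ, (∃ k : ℕ, k < 2 ^ j ∧ lam = 2 ^ (2 ^ j + k)) ∧
      (2 : ℝ) ^ (2 ^ j) ≤ lam ∧ lam < (2 : ℝ) ^ (2 ^ (j + 1)) ∧
      ENNReal.ofReal (lam ^ γ) * μ {x | ENNReal.ofReal (2 * lam) < g x} ≤
        ENNReal.ofReal ((2 : ℝ) ^ (-(j : ℝ))) * K := by
  obtain ⟨k, hk, hle⟩ : ∃ k < 2 ^ j,
      ((2 : ℝ≥0∞) ^ γ) ^ (2 ^ j + k) * μ {x | 2 ^ (2 ^ j + k + 1) < g x} ≤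
        (2 ^ j)⁻¹ * K := by
    by_contra! h
    have hlt := ENNReal.sum_lt_sum_of_nonempty (s := Finset.range (2 ^ j))
      (by simp) fun k hk => h k (Finset.mem_range.mp hk)
    refine absurd ((sum_dyadic_levels_mul_measure_le_lintegral μ hγ hg (2 ^ j) _).trans hint)
      (not_le.mpr (lt_of_eq_of_lt ?_ hlt))
    rw [Finset.sum_const, Finset.card_range, nsmul_eq_mul, ← mul_assoc]
    push_cast
    rw [ENNReal.mul_inv_cancel (by simp) (by simp), one_mul]
  refine ⟨2 ^ (2 ^ j + k), ⟨k, hk, rfl⟩, pow_le_pow_right₀ one_le_two (by omega),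
    pow_lt_pow_right₀ one_lt_two (by rw [pow_succ]; omega), ?_⟩
  have hlevel : ENNReal.ofReal (2 * 2 ^ (2 ^ j + k)) = 2 ^ (2 ^ j + k + 1) := by
    rw [← pow_succ', ENNReal.ofReal_pow zero_le_two, ENNReal.ofReal_ofNat]
  have hweight : ENNReal.ofReal (((2 : ℝ) ^ (2 ^ j + k)) ^ γ) =
      ((2 : ℝ≥0∞) ^ γ) ^ (2 ^ j + k) := by
    rw [← ENNReal.ofReal_rpow_of_pos (by positivity), ENNReal.ofReal_pow zero_le_two,
      ENNReal.ofReal_ofNat, ← ENNReal.rpow_natCast, ← ENNReal.rpow_natCast,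
      ← ENNReal.rpow_mul, ← ENNReal.rpow_mul, mul_comm]
  have hfactor : ENNReal.ofReal ((2 : ℝ) ^ (-(j : ℝ))) = (2 ^ j)⁻¹ := by
    rw [← ENNReal.ofReal_rpow_of_pos two_pos, ENNReal.ofReal_ofNat, ENNReal.rpow_neg,
      ENNReal.rpow_natCast]
  rw [hlevel, hweight, hfactor]
  exact hle
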